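/- Let F be a field of characteristic not equal to 2, let α be a partition of n, and let β be a one-box-shift of α. Then dim_F Hom_{FΣ_n}(S^α, S^β) ≤ 1. -/

import Mathlib

namespace CarterPayne

open Finset

/-- A partition of `n`, presented by its parts function; rows are indexed from `1`. -/
structure Partition (n : ℕ) where
  parts : ℕ → ℕ
  parts_zero : parts 0 = 0
  antitone : ∀ ⦃i j : ℕ⦄, 0 < i → i ≤ j → parts j ≤ parts i
  finite_support : (Function.support parts).Finite
  sum_parts : ∑ᶠ i, parts i = n

variable {n : ℕ}

/-- The set of cells `(row, column)` (both 1-indexed) of the Young diagram of `μ`. -/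
def Partition.cells (μ : Partition n) : Set (ℕ × ℕ) :=
  {c | 0 < c.1 ∧ 0 < c.2 ∧ c.2 ≤ μ.parts c.1}

/-- A tabloid for the composition `c` of `n`: an assignment of the `n` symbols to rows
(rows indexed from 1), row `i` receiving exactly `c i` symbols. -/
def Tabloid (n : ℕ) (c : ℕ → ℕ) : Type :=
  {g : Fin n → ℕ // ∀ i, (Finset.univ.filter fun k => g k = i).card = c i}

/-- The permutation module `M^c` over `R`: the free `R`-module on the set of tabloids. -/
abbrev PermMod (R : Type*) [CommRing R] (n : ℕ) (c : ℕ → ℕ) := Tabloid n c →₀ R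

/-- The action of a permutation of the symbols on tabloids. -/
def permTabloid (c : ℕ → ℕ) (π : Equiv.Perm (Fin n)) (f : Tabloid n c) : Tabloid n c :=
  ⟨fun k => f.1 (π.symm k), fun i => by
    rw [← f.2 i]
    exact Finset.card_equiv π.symm fun a => by simp⟩

/-- The `R`-linear action of a permutation of the symbols on `M^c`. -/
noncomputable def permM (R : Type*) [CommRing R] (c : ℕ → ℕ) (π : Equiv.Perm (Fin n)) :
    PermMod R n c →ₗ[R] PermMod R n c :=
  Finsupp.lmapDomain R R (permTabloid c π)

/-- A bijective `μ`-tableau, presented by the placement map which sends each of the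
`n` symbols to the cell of the Young diagram containing it. -/
structure Placement (μ : Partition n) where
  pos : Fin n → ℕ × ℕ
  mem : ∀ k, pos k ∈ μ.cells
  inj : Function.Injective pos
  surj : ∀ c ∈ μ.cells, ∃ k, pos k = c

/-- The column stabilizer of a bijective tableau, as a set of permutations of the symbols. -/
def colStab {μ : Partition n} (T : Placement μ) : Finset (Equiv.Perm (Fin n)) :=
  Finset.univ.filter fun π => ∀ k, (T.pos (π k)).2 = (T.pos k).2

lemma rowFiber_card {μ : Partition n} (T : Placement μ) (i : ℕ) :
    (Finset.univ.filter fun k => (T.pos k).1 = i).card = μ.parts i := by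
  classical
  have h : (Finset.univ.filter fun k => (T.pos k).1 = i).card
      = (Finset.Icc 1 (μ.parts i)).card := by
    apply Finset.card_bij (fun k _ => (T.pos k).2)
    · intro a ha
      simp only [Finset.mem_filter, Finset.mem_univ, true_and] at ha
      obtain ⟨h1, h2, h3⟩ := T.mem a
      exact Finset.mem_Icc.mpr ⟨h2, ha ▸ h3⟩
    · intro a ha b hb hab
      simp only [Finset.mem_filter, Finset.mem_univ, true_and] at ha hb
      exact T.inj (Prod.ext (ha.trans hb.symm) hab)
    · intro j hj
      rw [Finset.mem_Icc] at hj
      have hi0 : 0 < i := by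
        rcases Nat.eq_zero_or_pos i with h0 | h0
        · exfalso; rw [h0, μ.parts_zero] at hj; omega
        · exact h0
      obtain ⟨k, hk⟩ := T.surj (i, j) ⟨hi0, hj.1, hj.2⟩
      exact ⟨k, by simp [hk], by simp [hk]⟩
  rw [h, Nat.card_Icc]
  omega

/-- The row tabloid `{tπ}` associated to the bijective tableau `tπ`. -/
def rowTabloid {μ : Partition n} (T : Placement μ) (π : Equiv.Perm (Fin n)) :
    Tabloid n μ.parts :=
  ⟨fun k => (T.pos (π k)).1, fun i => by
    rw [← rowFiber_card T i]
    exact Finset.card_equiv π fun a => by simp⟩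

/-- The polytabloid `e_t` attached to a bijective tableau `t`. -/
noncomputable def polytabloid (R : Type*) [CommRing R] {μ : Partition n} (T : Placement μ) :
    PermMod R n μ.parts :=
  ∑ π ∈ colStab T, ((Equiv.Perm.sign π : ℤ) : R) • Finsupp.single (rowTabloid T π) (1 : R)

/-- The Specht module `S^μ`, the span in `M^μ` of all polytabloids. -/
noncomputable def Specht (R : Type*) [CommRing R] (μ : Partition n) :
    Submodule R (PermMod R n μ.parts) :=
  Submodule.span R (Set.range fun T : Placement μ => polytabloid R T)

/-- `β` is obtained from the partition `α` of `n` by moving one box from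
(the end of) row `a` to (the end of) row `b`; i.e. `β` is a one-box-shift of `α`. -/
structure OneBoxShift {n : ℕ} (α β : Partition n) (a b : ℕ) : Prop where
  a_pos : 0 < a
  a_lt_b : a < b
  rem : α.parts (a + 1) < α.parts a
  add : α.parts b < α.parts (b - 1)
  at_a : β.parts a = α.parts a - 1
  at_b : β.parts b = α.parts b + 1
  elsewhere : ∀ i, i ≠ a → i ≠ b → β.parts i = α.parts i

/-- The space of `RΣ_n`-homomorphisms from `S^α` to `M^c` whose image lies in the
submodule `target` of `M^c`; an `R`-linear map is an `RΣ_n`-homomorphism when it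
intertwines the permutation actions on source and target. -/
noncomputable def SpechtHom (R : Type*) [CommRing R] (α : Partition n) (c : ℕ → ℕ)
    (target : Submodule R (PermMod R n c)) :
    Submodule R (↥(Specht R α) →ₗ[R] PermMod R n c) where
  carrier := {f | (∀ x, f x ∈ target) ∧
    ∀ (π : Equiv.Perm (Fin n)) (x y : ↥(Specht R α)),
      (x : PermMod R n α.parts) = permM R α.parts π (y : PermMod R n α.parts) →
      f x = permM R c π (f y)}
  add_mem' := by
    rintro f g ⟨hf1, hf2⟩ ⟨hg1, hg2⟩
    refine ⟨fun x => target.add_mem (hf1 x) (hg1 x), fun π x y hxy => ?_⟩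
    simp only [LinearMap.add_apply, hf2 π x y hxy, hg2 π x y hxy, map_add]
  zero_mem' :=
    ⟨fun _ => target.zero_mem, fun π x y _ => by simp⟩
  smul_mem' := by
    rintro r f ⟨hf1, hf2⟩
    refine ⟨fun x => target.smul_mem r (hf1 x), fun π x y hxy => ?_⟩
    simp only [LinearMap.smul_apply, hf2 π x y hxy, map_smul]

section Core

/-- The defect of the filling `g` in rows up to `r` of column `c`. -/
def dl {α : Partition n} (T : Placement α) (g : Fin n → ℕ) (r c : ℕ) : ℤ :=
  ∑ k, if (T.pos k).2 = c then
    ((if (T.pos k).1 ≤ r then 1 else 0) - (if g k ≤ r then 1 else 0)) else 0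

/-- Fillings of weight `β` with distinct entries in each column. -/
structure Adm {α : Partition n} (T : Placement α) (β : Partition n) (g : Fin n → ℕ) : Prop where
  wt : ∀ i, (Finset.univ.filter fun k => g k = i).card = β.parts i
  cinj : ∀ k k', (T.pos k).2 = (T.pos k').2 → g k = g k' → k = k'

lemma Adm.pos {α β : Partition n} {T : Placement α} {g : Fin n → ℕ} (hg : Adm T β g) (k : Fin n) :
    1 ≤ g k := by
  by_contra h
  have h0 : g k = 0 := by omega
  have := hg.wt 0
  rw [β.parts_zero, Finset.card_eq_zero] at this
  have h1 : k ∈ (Finset.univ.filter fun k => g k = 0) := by simp [h0]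
  rw [this] at h1
  simp at h1

lemma dl_swap {α : Partition n} (T : Placement α) (g : Fin n → ℕ) (r c : ℕ) (k k' : Fin n) :
    dl T (g ∘ Equiv.swap k k') r c = dl T g r c
      + (if (T.pos k).2 = c then
          ((if g k ≤ r then 1 else 0) - (if g k' ≤ r then 1 else 0)) else 0)
      + (if (T.pos k').2 = c then
          ((if g k' ≤ r then 1 else 0) - (if g k ≤ r then 1 else 0)) else 0) := by
  classical
  by_cases hk : k = k'
  · subst hk
    simp
  have h1 : dl T (g ∘ Equiv.swap k k') r c - dl T g r c
      = ∑ x, if (T.pos x).2 = c then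
          ((if g x ≤ r then (1:ℤ) else 0) - (if g (Equiv.swap k k' x) ≤ r then 1 else 0))
          else 0 := by
    unfold dl
    rw [← Finset.sum_sub_distrib]
    apply Finset.sum_congr rfl
    intro x _
    simp only [Function.comp]
    split_ifs <;> simp
  have h2 := Finset.sum_eq_add (s := Finset.univ) (f := fun x => if (T.pos x).2 = c then
          ((if g x ≤ r then (1:ℤ) else 0) - (if g (Equiv.swap k k' x) ≤ r then 1 else 0))
          else 0) k k' hk (by
    intro x _ hx
    rw [Equiv.swap_apply_of_ne_of_ne hx.1 hx.2]; simp) (by simp) (by simp)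
  simp only [Equiv.swap_apply_left, Equiv.swap_apply_right] at h2
  linarith

lemma dl_sub {α : Partition n} {T : Placement α} {g : Fin n → ℕ} (r c : ℕ) :
    dl T g (r+1) c - dl T g r c =
      ((Finset.univ.filter fun k => (T.pos k).2 = c ∧ (T.pos k).1 = r+1).card : ℤ)
      - ((Finset.univ.filter fun k => (T.pos k).2 = c ∧ g k = r+1).card : ℤ) := by
  unfold dl
  rw [Finset.card_filter, Finset.card_filter]
  push_cast
  rw [← Finset.sum_sub_distrib, ← Finset.sum_sub_distrib]
  apply Finset.sum_congr rfl
  intro x _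
  split_ifs <;> omega

lemma cell_card {α : Partition n} (T : Placement α) (r c : ℕ) :
    (Finset.univ.filter fun k => (T.pos k).2 = c ∧ (T.pos k).1 = r+1).card
      = if 1 ≤ c ∧ c ≤ α.parts (r+1) then 1 else 0 := by
  split_ifs with h
  · obtain ⟨k, hk⟩ := T.surj (r+1, c) ⟨by simp, h.1, h.2⟩
    rw [Finset.card_eq_one]
    refine ⟨k, ?_⟩
    ext x
    simp only [Finset.mem_filter, Finset.mem_univ, true_and, Finset.mem_singleton]
    constructor
    · rintro ⟨h1, h2⟩
      apply T.inj
      rw [hk]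
      exact Prod.ext h2 h1
    · rintro rfl
      simp [hk]
  · rw [Finset.card_eq_zero]
    ext x
    simp only [Finset.mem_filter, Finset.mem_univ, true_and, Finset.notMem_empty, iff_false]
    rintro ⟨h1, h2⟩
    obtain ⟨_, h4, h5⟩ := T.mem x
    rw [h2] at h5
    rw [h1] at h4 h5
    exact h ⟨h4, h5⟩

lemma Adm.card_le {α β : Partition n} {T : Placement α} {g : Fin n → ℕ} (hg : Adm T β g)
    (r c : ℕ) : (Finset.univ.filter fun k => (T.pos k).2 = c ∧ g k = r).card ≤ 1 := by
  rw [Finset.card_le_one]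
  intro x hx y hy
  simp only [Finset.mem_filter, Finset.mem_univ, true_and] at hx hy
  exact hg.cinj x y (hx.1.trans hy.1.symm) (hx.2.trans hy.2.symm)

lemma Adm.dl_nonneg {α β : Partition n} {T : Placement α} {g : Fin n → ℕ} (hg : Adm T β g)
    (r c : ℕ) : 0 ≤ dl T g r c := by
  have h1 : dl T g r c = ((Finset.univ.filter fun k => (T.pos k).2 = c ∧ (T.pos k).1 ≤ r).card : ℤ)
      - ((Finset.univ.filter fun k => (T.pos k).2 = c ∧ g k ≤ r).card : ℤ) := by
    unfold dl
    rw [Finset.card_filter, Finset.card_filter]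
    push_cast
    rw [← Finset.sum_sub_distrib]
    apply Finset.sum_congr rfl
    intro x _
    split_ifs <;> simp_all
  rw [h1, sub_nonneg]
  norm_cast
  by_cases h : ∃ k, (T.pos k).2 = c ∧ r < (T.pos k).1
  · obtain ⟨k, hk1, hk2⟩ := h
    obtain ⟨m1, m2, m3⟩ := T.mem k
    trans (Finset.Icc 1 r).card
    · apply Finset.card_le_card_of_injOn g
      · intro x hx
        simp only [Finset.coe_filter, Finset.mem_univ, true_and, Set.mem_ofPred_eq] at hx
        simp only [Finset.coe_Icc, Set.mem_Icc]
        exact ⟨hg.pos x, hx.2⟩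
      · intro x hx y hy hxy
        simp only [Finset.coe_filter, Finset.mem_univ, true_and, Set.mem_ofPred_eq] at hx hy
        exact hg.cinj x y (hx.1.trans hy.1.symm) hxy
    · apply Finset.card_le_card_of_surjOn (fun k => (T.pos k).1)
      intro i hi
      simp only [Finset.coe_Icc, Set.mem_Icc] at hi
      obtain ⟨x, hx⟩ := T.surj (i, c) ⟨hi.1, hk1 ▸ m2, by
        have := α.antitone (i := i) (j := (T.pos k).1) hi.1 (by omega)
        simp only
        omega⟩
      refine ⟨x, ?_, by simp [hx]⟩
      simp [hx, hi.2]
  · push Not at h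
    apply Finset.card_le_card
    intro x hx
    simp only [Finset.mem_filter, Finset.mem_univ, true_and] at hx ⊢
    exact ⟨hx.1, h x hx.1⟩

lemma sum_le_card (f : Fin n → ℕ) (r : ℕ) :
    (∑ k, if f k ≤ r then (1:ℤ) else 0)
      = ∑ i ∈ Finset.range (r+1), ((Finset.univ.filter fun k => f k = i).card : ℤ) := by
  simp only [Finset.card_filter]
  push_cast
  rw [Finset.sum_comm]
  apply Finset.sum_congr rfl
  intro x _
  rw [Finset.sum_ite_eq]
  simp

lemma Adm.dl_total {α β : Partition n} {T : Placement α} {g : Fin n → ℕ} (hg : Adm T β g)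
    {a b : ℕ} (hs : OneBoxShift α β a b) (r : ℕ) :
    ∑ c ∈ Finset.univ.image (fun k => (T.pos k).2), dl T g r c
      = if a ≤ r ∧ r < b then 1 else 0 := by
  unfold dl
  rw [Finset.sum_comm]
  have h1 : ∀ k : Fin n, (∑ c ∈ Finset.univ.image (fun k => (T.pos k).2),
      if (T.pos k).2 = c then
    ((if (T.pos k).1 ≤ r then (1:ℤ) else 0) - (if g k ≤ r then 1 else 0)) else 0)
      = (if (T.pos k).1 ≤ r then (1:ℤ) else 0) - (if g k ≤ r then 1 else 0) := by
    intro k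
    rw [Finset.sum_ite_eq, if_pos]
    exact Finset.mem_image_of_mem _ (Finset.mem_univ k)
  rw [Finset.sum_congr rfl (fun k _ => h1 k), Finset.sum_sub_distrib, sum_le_card, sum_le_card,
    ← Finset.sum_sub_distrib]
  have h2 : ∀ i, ((Finset.univ.filter fun k => (T.pos k).1 = i).card : ℤ)
      - ((Finset.univ.filter fun k => g k = i).card : ℤ)
      = (if a = i then 1 else 0) - (if b = i then 1 else 0) := by
    intro i
    rw [rowFiber_card, hg.wt]
    have := hs.a_lt_b
    have h3 := hs.rem
    by_cases ha : a = i
    · subst ha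
      rw [hs.at_a, if_pos rfl, if_neg (by omega)]
      omega
    · by_cases hb : b = i
      · subst hb
        rw [hs.at_b, if_pos rfl, if_neg ha]
        push_cast; ring
      · rw [hs.elsewhere i (Ne.symm ha) (Ne.symm hb), if_neg ha, if_neg hb]
        ring
  rw [Finset.sum_congr rfl (fun i _ => h2 i), Finset.sum_sub_distrib, Finset.sum_ite_eq,
    Finset.sum_ite_eq]
  have := hs.a_lt_b
  simp only [Finset.mem_range]
  split_ifs <;> omega

lemma dl_notMem {α : Partition n} {T : Placement α} {g : Fin n → ℕ} {r c : ℕ}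
    (hc : c ∉ Finset.univ.image (fun k => (T.pos k).2)) : dl T g r c = 0 := by
  unfold dl
  apply Finset.sum_eq_zero
  intro k _
  rw [if_neg]
  rintro rfl
  exact hc (Finset.mem_image_of_mem _ (Finset.mem_univ k))

lemma Adm.dl_out {α β : Partition n} {T : Placement α} {g : Fin n → ℕ} (hg : Adm T β g)
    {a b : ℕ} (hs : OneBoxShift α β a b) {r : ℕ} (hr : ¬ (a ≤ r ∧ r < b)) (c : ℕ) :
    dl T g r c = 0 := by
  by_cases hc : c ∈ Finset.univ.image (fun k => (T.pos k).2)
  · have h := hg.dl_total hs r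
    rw [if_neg hr, Finset.sum_eq_zero_iff_of_nonneg (fun c _ => hg.dl_nonneg r c)] at h
    exact h c hc
  · exact dl_notMem hc

lemma Adm.dl_ex {α β : Partition n} {T : Placement α} {g : Fin n → ℕ} (hg : Adm T β g)
    {a b : ℕ} (hs : OneBoxShift α β a b) {r : ℕ} (hr1 : a ≤ r) (hr2 : r < b) :
    ∃ c, dl T g r c = 1 ∧ ∀ c', c' ≠ c → dl T g r c' = 0 := by
  have h := hg.dl_total hs r
  rw [if_pos ⟨hr1, hr2⟩] at h
  obtain ⟨c, hc, hc0⟩ : ∃ c ∈ Finset.univ.image (fun k => (T.pos k).2), dl T g r c ≠ 0 := by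
    by_contra hcon
    push Not at hcon
    rw [Finset.sum_eq_zero hcon] at h
    simp at h
  rw [← Finset.add_sum_erase _ _ hc] at h
  have h1 := hg.dl_nonneg r c
  have h2 : 0 ≤ ∑ x ∈ (Finset.univ.image (fun k => (T.pos k).2)).erase c, dl T g r x :=
    Finset.sum_nonneg fun x _ => hg.dl_nonneg r x
  refine ⟨c, by omega, fun c' hc' => ?_⟩
  by_cases hm : c' ∈ Finset.univ.image (fun k => (T.pos k).2)
  · have h3 : ∑ x ∈ (Finset.univ.image (fun k => (T.pos k).2)).erase c, dl T g r x = 0 := by omega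
    rw [Finset.sum_eq_zero_iff_of_nonneg (fun c _ => hg.dl_nonneg r c)] at h3
    exact h3 c' (Finset.mem_erase.2 ⟨hc', hm⟩)
  · exact dl_notMem hm

lemma Adm.dl_uniq {α β : Partition n} {T : Placement α} {g : Fin n → ℕ} (hg : Adm T β g)
    {a b : ℕ} (hs : OneBoxShift α β a b) {r c c' : ℕ} (h1 : dl T g r c = 1) (h : c' ≠ c) :
    dl T g r c' = 0 := by
  by_cases hr : a ≤ r ∧ r < b
  · obtain ⟨c0, h2, h3⟩ := hg.dl_ex hs hr.1 hr.2
    by_cases hc : c = c0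
    · subst hc; exact h3 _ h
    · rw [h3 c hc] at h1; simp at h1
  · exact hg.dl_out hs hr _

lemma Adm.dl_01 {α β : Partition n} {T : Placement α} {g : Fin n → ℕ} (hg : Adm T β g)
    {a b : ℕ} (hs : OneBoxShift α β a b) (r c : ℕ) : dl T g r c = 0 ∨ dl T g r c = 1 := by
  by_cases hr : a ≤ r ∧ r < b
  · obtain ⟨c0, h2, h3⟩ := hg.dl_ex hs hr.1 hr.2
    by_cases hc : c = c0
    · subst hc; exact Or.inr h2
    · exact Or.inl (h3 c hc)
  · exact Or.inl (hg.dl_out hs hr _)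

/-- One step of the defect in column `c`. -/
lemma Adm.step {α β : Partition n} {T : Placement α} {g : Fin n → ℕ} (hg : Adm T β g) (r c : ℕ) :
    ((∃ k, (T.pos k).2 = c ∧ g k = r+1) ∧
      dl T g (r+1) c - dl T g r c = (if 1 ≤ c ∧ c ≤ α.parts (r+1) then 1 else 0) - 1) ∨
    ((¬ ∃ k, (T.pos k).2 = c ∧ g k = r+1) ∧
      dl T g (r+1) c - dl T g r c = (if 1 ≤ c ∧ c ≤ α.parts (r+1) then 1 else 0)) := by
  have h := dl_sub (T := T) (g := g) r c
  rw [cell_card] at h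
  have h1 := hg.card_le (r+1) c
  by_cases hk : ∃ k, (T.pos k).2 = c ∧ g k = r+1
  · left
    refine ⟨hk, ?_⟩
    obtain ⟨k, hk⟩ := hk
    have : 0 < (Finset.univ.filter fun k => (T.pos k).2 = c ∧ g k = r+1).card :=
      Finset.card_pos.2 ⟨k, by simpa using hk⟩
    have h2 : (Finset.univ.filter fun k => (T.pos k).2 = c ∧ g k = r+1).card = 1 := by omega
    rw [h, h2]; push_cast; rfl
  · right
    refine ⟨hk, ?_⟩
    have h2 : (Finset.univ.filter fun k => (T.pos k).2 = c ∧ g k = r+1).card = 0 := by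
      rw [Finset.card_eq_zero, Finset.filter_eq_empty_iff]
      intro x _ hx
      exact hk ⟨x, hx⟩
    rw [h, h2]; push_cast; ring

/-- The columns used by the full chain. -/
def chainCol (α : Partition n) : ℕ → ℕ
  | 0 => 0
  | r+1 => if α.parts (r+2) < α.parts (r+1) then α.parts (r+1) else chainCol α r

lemma chainCol_gt {α β : Partition n} {a b : ℕ} (hs : OneBoxShift α β a b) (r : ℕ) (hr : a ≤ r) :
    α.parts (r+1) < chainCol α r := by
  induction r, hr using Nat.le_induction with
  | base =>
    obtain ⟨a', rfl⟩ : ∃ a', a = a'+1 := ⟨a-1, by have := hs.a_pos; omega⟩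
    have := hs.rem
    unfold chainCol
    rw [if_pos this]; exact this
  | succ r hr ih =>
    unfold chainCol
    split_ifs with h
    · exact h
    · have := α.antitone (i := r+1) (j := r+2) (by omega) (by omega)
      have : α.parts (r+1+1) = α.parts (r+2) := rfl
      omega

lemma Adm.swap {α β : Partition n} {T : Placement α} {g : Fin n → ℕ} (hg : Adm T β g)
    (k k' : Fin n) (h : ∀ x y, (T.pos x).2 = (T.pos y).2 →
      (g ∘ Equiv.swap k k') x = (g ∘ Equiv.swap k k') y → x = y) :
    Adm T β (g ∘ Equiv.swap k k') := by
  refine ⟨fun i => ?_, h⟩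
  rw [← hg.wt i]
  exact Finset.card_equiv (Equiv.swap k k') fun x => by simp

variable {F : Type*} [Field F] {α β : Partition n} {T : Placement α} {a b : ℕ}
  {X : (Fin n → ℕ) → F}

/-- Kernel relation, swap form: if every other swapped admissible filling vanishes, so does `g`. -/
lemma raise_step
    (hX1 : ∀ g k k', k ≠ k' → (T.pos k).2 = (T.pos k').2 → g k = g k' → X g = 0)
    (hX2 : ∀ h i, 1 ≤ i →
      ∑ k ∈ Finset.univ.filter (fun k => h k = i), X (Function.update h k (i+1)) = 0)
    {g : Fin n → ℕ} (hg : Adm T β g) {i : ℕ} (hi : 1 ≤ i) {k : Fin n} (hk : g k = i+1)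
    (H : ∀ k', g k' = i → Adm T β (g ∘ Equiv.swap k k') → X (g ∘ Equiv.swap k k') = 0) :
    X g = 0 := by
  classical
  have h := hX2 (Function.update g k i) i hi
  rw [Finset.sum_eq_single k] at h
  · rw [Function.update_idem, ← hk, Function.update_eq_self] at h
    exact h
  · intro k' hk' hne
    simp only [Finset.mem_filter, Finset.mem_univ, true_and] at hk'
    rw [Function.update_of_ne hne] at hk'
    have e : Function.update (Function.update g k i) k' (i+1) = g ∘ Equiv.swap k k' := by
      funext x
      simp only [Function.comp]
      by_cases h1 : x = k'
      · subst h1; simp [hk]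
      · by_cases h2 : x = k
        · subst h2; simp [h1, hk']
        · rw [Equiv.swap_apply_of_ne_of_ne h2 h1]; simp [h1, h2]
    rw [e]
    by_cases hadm : ∀ x y, (T.pos x).2 = (T.pos y).2 →
      (g ∘ Equiv.swap k k') x = (g ∘ Equiv.swap k k') y → x = y
    · exact H k' hk' (hg.swap k k' hadm)
    · push Not at hadm
      obtain ⟨x, y, h1, h2, h3⟩ := hadm
      exact hX1 _ x y h3 h1 h2
  · intro hn
    simp at hn

/-- The defect of `g` follows the full chain below row `r`. -/
def Pre (T : Placement α) (a : ℕ) (g : Fin n → ℕ) (r : ℕ) : Prop :=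
  ∀ i, a ≤ i → i < r → dl T g i (chainCol α i) = 1

lemma core_nonrem (hs : OneBoxShift α β a b)
    (hX1 : ∀ g k k', k ≠ k' → (T.pos k).2 = (T.pos k').2 → g k = g k' → X g = 0)
    (hX2 : ∀ h i, 1 ≤ i →
      ∑ k ∈ Finset.univ.filter (fun k => h k = i), X (Function.update h k (i+1)) = 0)
    (r : ℕ) (hra : a ≤ r) (hrb : r < b) (hnr : α.parts (r+1) = α.parts r)
    (IH : ∀ g, Adm T β g → Pre T a g (r+1) → X g = 0)
    (g : Fin n → ℕ) (hg : Adm T β g) (hp : Pre T a g r) : X g = 0 := by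
  have ha := hs.a_pos
  have hra' : a < r := by
    rcases Nat.lt_or_ge a r with h | h
    · exact h
    · have : a = r := by omega
      subst this
      have := hs.rem
      omega
  have hrb' : r + 1 < b := by
    rcases Nat.lt_or_ge (r+1) b with h | h
    · exact h
    · have : b = r + 1 := by omega
      subst this
      have := hs.add
      simp at this
      omega
  obtain ⟨q, rfl⟩ : ∃ q, r = q + 1 := ⟨r-1, by omega⟩
  have hL : chainCol α (q+1) = chainCol α q := by
    rw [chainCol, if_neg]
    have : α.parts (q+1+1) = α.parts (q+2) := rfl
    omega
  obtain ⟨c, hc1, hc2⟩ := hg.dl_ex hs hra hrb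
  by_cases hcL : c = chainCol α (q+1)
  · apply IH g hg
    intro i h1 h2
    by_cases h3 : i = q+1
    · rw [h3, ← hcL]; exact hc1
    · exact hp i h1 (by omega)
  have hq := hp q (by omega) (by omega)
  have hqc : dl T g q c = 0 := hg.dl_uniq hs hq (by rw [← hL]; exact hcL)
  have hcα : (1 ≤ c ∧ c ≤ α.parts (q+1)) ∧ ¬ ∃ k, (T.pos k).2 = c ∧ g k = q+1 := by
    have := hg.step q c
    rw [hc1, hqc] at this
    by_cases h : 1 ≤ c ∧ c ≤ α.parts (q+1)
    · rw [if_pos h] at this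
      rcases this with h | h
      · simp at h
      · exact ⟨by assumption, h.1⟩
    · rw [if_neg h] at this
      rcases this with h | h <;> simp at h
  have hst := hg.step (q+1) c
  rw [if_pos (by omega), hc1] at hst
  have hd2 : dl T g (q+1+1) c = 1 ∧ ∃ k, (T.pos k).2 = c ∧ g k = q+1+1 := by
    rcases hst with h | h
    · exact ⟨by omega, h.1⟩
    · rcases hg.dl_01 hs (q+1+1) c with h' | h' <;> omega
  obtain ⟨hd2, k, hkc, hk⟩ := hd2
  apply raise_step hX1 hX2 hg (by omega) hk
  intro k' hk' hadm
  have hcol : (T.pos k').2 ≠ c := fun h => hcα.2 ⟨k', h, hk'⟩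
  apply IH _ hadm
  have hsame : ∀ i c', i ≠ q+1 → dl T (g ∘ Equiv.swap k k') i c' = dl T g i c' := by
    intro i c' hi
    rw [dl_swap, hk, hk']
    split_ifs <;> omega
  have hnew : dl T (g ∘ Equiv.swap k k') (q+1) (T.pos k').2 = 1 := by
    rw [dl_swap, hk, hk', hc2 _ hcol, hkc, if_neg (Ne.symm hcol)]
    simp
  have hcL' : (T.pos k').2 = chainCol α (q+1) := by
    by_contra hne
    have h0 : dl T (g ∘ Equiv.swap k k') q (T.pos k').2 = 0 := by
      rw [hsame _ _ (by omega)]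
      exact hg.dl_uniq hs hq (by rw [← hL]; exact hne)
    have h3 : dl T (g ∘ Equiv.swap k k') (q+1+1) (T.pos k').2 = 0 := by
      rw [hsame _ _ (by omega)]
      exact hg.dl_uniq hs hd2 hcol
    have s1 := hadm.step q (T.pos k').2
    have s2 := hadm.step (q+1) (T.pos k').2
    rw [hnr] at s2
    rw [hnew, h0] at s1
    rw [hnew, h3] at s2
    split_ifs at s1 s2 <;> omega
  intro i h1 h2
  by_cases h3 : i = q+1
  · rw [h3, ← hcL']; exact hnew
  · rw [hsame _ _ h3]; exact hp i h1 (by omega)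

lemma core_garnir (hs : OneBoxShift α β a b)
    (hX1 : ∀ g k k', k ≠ k' → (T.pos k).2 = (T.pos k').2 → g k = g k' → X g = 0)
    (hX3 : ∀ g k c, 1 ≤ c → c < (T.pos k).2 →
      X g = ∑ y ∈ Finset.univ.filter (fun y => (T.pos y).2 = c), X (g ∘ Equiv.swap k y))
    (r : ℕ) (hra : a ≤ r) (hrm : α.parts (r+1) < α.parts r)
    (IH : ∀ g, Adm T β g → Pre T a g (r+1) → X g = 0)
    (g : Fin n → ℕ) (hg : Adm T β g) (hp : Pre T a g r)
    (c : ℕ) (hc1 : 1 ≤ c) (hc2 : c ≤ α.parts r) (hc : dl T g r c = 1) : X g = 0 := by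
  have ha := hs.a_pos
  obtain ⟨q, rfl⟩ : ∃ q, r = q + 1 := ⟨r-1, by omega⟩
  have hL : chainCol α (q+1) = α.parts (q+1) := by
    rw [chainCol, if_pos hrm]
  have IH' : ∀ g, Adm T β g → Pre T a g (q+1) → dl T g (q+1) (α.parts (q+1)) = 1 → X g = 0 := by
    intro g hg hp h
    apply IH g hg
    intro i h1 h2
    by_cases h3 : i = q+1
    · rw [h3, hL]; exact h
    · exact hp i h1 (by omega)
  by_cases hcl : c = α.parts (q+1)
  · exact IH' g hg hp (hcl ▸ hc)
  -- columns at most `α_r` are not defective before row `r`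
  have hz : ∀ c' i, c' ≤ α.parts (q+1) → i < q+1 → dl T g i c' = 0 := by
    intro c' i h1 h2
    by_cases h3 : a ≤ i
    · apply hg.dl_uniq hs (hp i h3 h2)
      have := chainCol_gt hs i h3
      have := α.antitone (i := i+1) (j := q+1) (by omega) (by omega)
      omega
    · exact hg.dl_out hs (by omega) _
  have hl0 : dl T g (q+1) (α.parts (q+1)) = 0 := hg.dl_uniq hs hc (Ne.symm hcl)
  have s1 := hg.step q (α.parts (q+1))
  rw [hl0, hz _ q le_rfl (by omega), if_pos (by omega)] at s1
  obtain ⟨k, hkc, hk⟩ : ∃ k, (T.pos k).2 = α.parts (q+1) ∧ g k = q+1 := by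
    rcases s1 with h | h
    · exact h.1
    · simp at h
  have s2 := hg.step q c
  rw [hc, hz _ q hc2 (by omega), if_pos (by omega)] at s2
  have hno : ¬ ∃ y, (T.pos y).2 = c ∧ g y = q+1 := by
    rcases s2 with h | h
    · simp at h
    · exact h.1
  rw [hX3 g k c hc1 (by omega)]
  apply Finset.sum_eq_zero
  intro y hy
  simp only [Finset.mem_filter, Finset.mem_univ, true_and] at hy
  by_cases hadm' : ∀ x z, (T.pos x).2 = (T.pos z).2 →
      (g ∘ Equiv.swap k y) x = (g ∘ Equiv.swap k y) z → x = z
  · have hadm := hg.swap k y hadm'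
    have hyr : g y ≠ q+1 := fun h => hno ⟨y, hy, h⟩
    have hyr' : q+1 < g y := by
      by_contra hcon
      have h1 := hadm.dl_nonneg (g y) (α.parts (q+1))
      have hne : (T.pos y).2 ≠ α.parts (q+1) := by omega
      rw [dl_swap, hz _ _ le_rfl (by omega), hk, if_pos hkc, if_neg hne] at h1
      split_ifs at h1 <;> omega
    apply IH' _ hadm
    · intro i h1 h2
      rw [dl_swap, hk, hp i h1 h2]
      split_ifs <;> omega
    · have hne : (T.pos y).2 ≠ α.parts (q+1) := by omega
      rw [dl_swap, hk, hl0, if_pos hkc, if_neg hne]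
      split_ifs <;> omega
  · push Not at hadm'
    obtain ⟨x, y, h1, h2, h3⟩ := hadm'
    exact hX1 _ x y h3 h1 h2

lemma core_rem (hs : OneBoxShift α β a b)
    (hX1 : ∀ g k k', k ≠ k' → (T.pos k).2 = (T.pos k').2 → g k = g k' → X g = 0)
    (hX2 : ∀ h i, 1 ≤ i →
      ∑ k ∈ Finset.univ.filter (fun k => h k = i), X (Function.update h k (i+1)) = 0)
    (hX3 : ∀ g k c, 1 ≤ c → c < (T.pos k).2 →
      X g = ∑ y ∈ Finset.univ.filter (fun y => (T.pos y).2 = c), X (g ∘ Equiv.swap k y))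
    (r : ℕ) (hra : a ≤ r) (hrb : r < b) (hrm : α.parts (r+1) < α.parts r)
    (IH : ∀ g, Adm T β g → Pre T a g (r+1) → X g = 0)
    (g : Fin n → ℕ) (hg : Adm T β g) (hp : Pre T a g r) : X g = 0 := by
  have ha := hs.a_pos
  have key : ∀ g, Adm T β g → Pre T a g r → ∀ c, dl T g r c = 1 → dl T g (r-1) c = 0 →
      X g = 0 := by
    intro g hg hp c h1 h2
    have s := hg.step (r-1) c
    rw [show r - 1 + 1 = r by omega, h1, h2] at s
    by_cases h : 1 ≤ c ∧ c ≤ α.parts r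
    · exact core_garnir hs hX1 hX3 r hra hrm IH g hg hp c h.1 h.2 h1
    · rw [if_neg h] at s
      rcases s with s | s <;> simp at s
  by_cases hra' : r ≤ a
  · obtain ⟨c, hc, -⟩ := hg.dl_ex hs hra hrb
    exact key g hg hp c hc (hg.dl_out hs (by omega) _)
  obtain ⟨q, rfl⟩ : ∃ q, r = q + 1 := ⟨r-1, by omega⟩
  have hLgt := chainCol_gt hs q (by omega)
  have Z : ∀ s, q+1 ≤ s → s ≤ b → ∀ g, Adm T β g → Pre T a g (q+1) →
      dl T g s (chainCol α q) = 0 → X g = 0 := by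
    intro s hs1
    induction s, hs1 using Nat.le_induction with
    | base =>
      intro _ g hg hp h0
      obtain ⟨c, hc, -⟩ := hg.dl_ex hs hra hrb
      refine key g hg hp c hc ?_
      apply hg.dl_uniq hs (hp q (by omega) (by omega))
      rintro rfl
      omega
    | succ s hs1 ih =>
      intro hsb g hg hp h0
      rcases hg.dl_01 hs s (chainCol α q) with h1 | h1
      · exact ih (by omega) g hg hp h1
      have hanti : ∀ i, q+1 ≤ i → α.parts i ≤ α.parts (q+1) :=
        fun i hi => α.antitone (by omega) hi
      have s1 := hg.step s (chainCol α q)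
      have := hanti (s+1) (by omega)
      rw [h0, h1, if_neg (by omega)] at s1
      obtain ⟨k, hkc, hk⟩ : ∃ k, (T.pos k).2 = chainCol α q ∧ g k = s+1 := by
        rcases s1 with h | h
        · exact h.1
        · simp at h
      apply raise_step hX1 hX2 hg (by omega) hk
      intro k' hk' hadm
      have hcol : (T.pos k').2 ≠ chainCol α q := by
        intro hcon
        have s2 := hg.step (s-1) (chainCol α q)
        have := hanti s (by omega)
        rw [show s - 1 + 1 = s by omega, h1, if_neg (by omega)] at s2
        have h01 := hg.dl_01 hs (s-1) (chainCol α q)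
        rcases s2 with h | h
        · omega
        · exact h.1 ⟨k', hcon, hk'⟩
      apply ih (by omega) _ hadm
      · intro i i1 i2
        rw [dl_swap, hk, hk', hp i i1 i2]
        split_ifs <;> omega
      · rw [dl_swap, hk, hk', h1, if_pos hkc, if_neg hcol]
        simp
  exact Z b (by omega) le_rfl g hg hp (hg.dl_out hs (by omega) _)

lemma core_perm (hs : OneBoxShift α β a b) {g g0 : Fin n → ℕ}
    (hg : Adm T β g) (hg0 : Adm T β g0) (hp : Pre T a g b) (hp0 : Pre T a g0 b) :
    ∃ π ∈ colStab T, g = g0 ∘ π := by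
  have hd : ∀ r c, dl T g r c = dl T g0 r c := by
    intro r c
    by_cases hr : a ≤ r ∧ r < b
    · have h1 := hp r hr.1 hr.2
      have h2 := hp0 r hr.1 hr.2
      by_cases hc : c = chainCol α r
      · rw [hc, h1, h2]
      · rw [hg.dl_uniq hs h1 hc, hg0.dl_uniq hs h2 hc]
    · rw [hg.dl_out hs hr, hg0.dl_out hs hr]
  have hex : ∀ k, ∃ k', (T.pos k').2 = (T.pos k).2 ∧ g0 k' = g k := by
    intro k
    have hk := hg.pos k
    have s1 := hg.step (g k - 1) (T.pos k).2
    have s2 := hg0.step (g k - 1) (T.pos k).2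
    rw [hd, hd] at s1
    rw [show g k - 1 + 1 = g k by omega] at s1 s2
    rcases s1 with s1 | s1
    · rcases s2 with s2 | s2
      · exact s2.1
      · omega
    · exact absurd ⟨k, rfl, rfl⟩ s1.1
  choose p hp1 hp2 using hex
  have hinj : Function.Injective p := by
    intro x y hxy
    apply hg.cinj x y
    · rw [← hp1 x, ← hp1 y, hxy]
    · rw [← hp2 x, ← hp2 y, hxy]
  refine ⟨Equiv.ofBijective p (Finite.injective_iff_bijective.1 hinj), ?_, ?_⟩
  · simp only [colStab, Finset.mem_filter, Finset.mem_univ, true_and]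
    exact hp1
  · funext k
    exact (hp2 k).symm

/-- Combinatorial core: everything vanishes as soon as the full chain coefficients vanish. -/
lemma core (hs : OneBoxShift α β a b)
    (hX1 : ∀ g k k', k ≠ k' → (T.pos k).2 = (T.pos k').2 → g k = g k' → X g = 0)
    (hX2 : ∀ h i, 1 ≤ i →
      ∑ k ∈ Finset.univ.filter (fun k => h k = i), X (Function.update h k (i+1)) = 0)
    (hX3 : ∀ g k c, 1 ≤ c → c < (T.pos k).2 →
      X g = ∑ y ∈ Finset.univ.filter (fun y => (T.pos y).2 = c), X (g ∘ Equiv.swap k y))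
    (H : ∀ g, Adm T β g → Pre T a g b → X g = 0)
    (g : Fin n → ℕ) (hg : Adm T β g) : X g = 0 := by
  have Q : ∀ d r, a ≤ r → r + d = b → ∀ g, Adm T β g → Pre T a g r → X g = 0 := by
    intro d
    induction d with
    | zero =>
      intro r _ hr g hg hp
      have : r = b := by omega
      exact H g hg (this ▸ hp)
    | succ d ih =>
      intro r hra hr
      have IH := ih (r+1) (by omega) (by omega)
      have ha := hs.a_pos
      have hle := α.antitone (i := r) (j := r+1) (by omega) (by omega)
      rcases Nat.eq_or_lt_of_le hle with h | h
      · exact core_nonrem hs hX1 hX2 r hra (by omega) h IH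
      · exact core_rem hs hX1 hX2 hX3 r hra (by omega) h IH
  have := hs.a_lt_b
  exact Q (b - a) a le_rfl (by omega) g hg (fun i h1 h2 => by omega)

end Core

section Alg

variable {F : Type*} [Field F]

open Classical in
/-- Coefficient of the row assignment `g`. -/
noncomputable def evL (F : Type*) [Field F] (c : ℕ → ℕ) (g : Fin n → ℕ) : PermMod F n c →ₗ[F] F :=
  if h : ∀ i, (Finset.univ.filter fun k => g k = i).card = c i then
    Finsupp.lapply (⟨g, h⟩ : Tabloid n c) else 0

lemma evL_tab (c : ℕ → ℕ) (t : Tabloid n c) (v : PermMod F n c) : evL F c t.1 v = v t := by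
  unfold evL
  rw [dif_pos t.2]
  rfl

lemma evL_of_not (c : ℕ → ℕ) (g : Fin n → ℕ) (v : PermMod F n c)
    (h : ¬ ∀ i, (Finset.univ.filter fun k => g k = i).card = c i) : evL F c g v = 0 := by
  unfold evL
  rw [dif_neg h]
  rfl

lemma evL_single (c : ℕ → ℕ) (g : Fin n → ℕ) (t : Tabloid n c) (x : F) :
    evL F c g (Finsupp.single t x) = if t.1 = g then x else 0 := by
  classical
  by_cases h : ∀ i, (Finset.univ.filter fun k => g k = i).card = c i
  · obtain ⟨u, rfl⟩ : ∃ u : Tabloid n c, u.1 = g := ⟨⟨g, h⟩, rfl⟩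
    rw [evL_tab, Finsupp.single_apply]
    by_cases ht : t = u
    · rw [if_pos ht, if_pos (congrArg Subtype.val ht)]
    · rw [if_neg ht, if_neg]
      intro hcon
      exact ht (Subtype.ext hcon)
  · rw [evL_of_not _ _ _ h, if_neg]
    rintro rfl
    exact h t.2

lemma evL_row {μ : Partition n} (U : Placement μ) (σ : Equiv.Perm (Fin n)) (g : Fin n → ℕ) (x : F) :
    evL F μ.parts g (Finsupp.single (rowTabloid U σ) x)
      = if (fun k => (U.pos (σ k)).1) = g then x else 0 :=
  evL_single _ _ _ _

lemma evL_permM (c : ℕ → ℕ) (g : Fin n → ℕ) (π : Equiv.Perm (Fin n)) (v : PermMod F n c) :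
    evL F c g (permM F c π v) = evL F c (g ∘ π) v := by
  have : (evL F c g).comp (permM F c π) = evL F c (g ∘ π) := by
    apply Finsupp.lhom_ext
    intro t x
    simp only [LinearMap.comp_apply, permM, Finsupp.lmapDomain_apply, Finsupp.mapDomain_single]
    rw [evL_single, evL_single]
    congr 1
    apply propext
    constructor
    · rintro rfl
      funext k
      simp [permTabloid]
    · intro h
      funext k
      simp [permTabloid, h]
  exact LinearMap.congr_fun this v

lemma mem_colStab {μ : Partition n} (T : Placement μ) (π : Equiv.Perm (Fin n)) :
    π ∈ colStab T ↔ ∀ k, (T.pos (π k)).2 = (T.pos k).2 := by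
  simp [colStab]

lemma mul_mem_colStab {μ : Partition n} {T : Placement μ} {σ π : Equiv.Perm (Fin n)}
    (h1 : σ ∈ colStab T) (h2 : π ∈ colStab T) : σ * π ∈ colStab T := by
  rw [mem_colStab] at *
  intro k
  rw [Equiv.Perm.mul_apply, h1, h2]

lemma inv_mem_colStab {μ : Partition n} {T : Placement μ} {π : Equiv.Perm (Fin n)}
    (h2 : π ∈ colStab T) : π⁻¹ ∈ colStab T := by
  rw [mem_colStab] at *
  intro k
  have := h2 (π⁻¹ k)
  simpa using this.symm

lemma swap_mem_colStab {μ : Partition n} {T : Placement μ} {k k' : Fin n}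
    (h : (T.pos k).2 = (T.pos k').2) : Equiv.swap k k' ∈ colStab T := by
  rw [mem_colStab]
  intro x
  rw [Equiv.swap_apply_def]
  split_ifs with h1 h2
  · rw [h1, h]
  · rw [h2, h]
  · rfl

lemma permM_row {μ : Partition n} (T : Placement μ) (σ π : Equiv.Perm (Fin n)) (x : F) :
    permM F μ.parts π (Finsupp.single (rowTabloid T σ) x)
      = Finsupp.single (rowTabloid T (σ * π⁻¹)) x := by
  simp only [permM, Finsupp.lmapDomain_apply, Finsupp.mapDomain_single]
  rfl

lemma permM_poly_col {μ : Partition n} (T : Placement μ) {π : Equiv.Perm (Fin n)}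
    (hπ : π ∈ colStab T) :
    permM F μ.parts π (polytabloid F T) = ((Equiv.Perm.sign π : ℤ) : F) • polytabloid F T := by
  unfold polytabloid
  rw [map_sum, Finset.smul_sum]
  apply Finset.sum_bij (fun σ _ => σ * π⁻¹)
  · intro σ hσ
    exact mul_mem_colStab hσ (inv_mem_colStab hπ)
  · intro σ _ τ _ h
    exact mul_right_cancel h
  · intro σ hσ
    exact ⟨σ * π, mul_mem_colStab hσ hπ, by simp⟩
  · intro σ hσ
    rw [map_smul, permM_row, smul_smul]
    congr 1
    rw [Equiv.Perm.sign_mul, Equiv.Perm.sign_inv]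
    rcases Int.units_eq_one_or (Equiv.Perm.sign π) with h | h <;> simp [h]

/-- Move a placement by a permutation. -/
def Placement.move {μ : Partition n} (T : Placement μ) (π : Equiv.Perm (Fin n)) : Placement μ where
  pos k := T.pos (π⁻¹ k)
  mem k := T.mem _
  inj := T.inj.comp (π⁻¹).injective
  surj c hc := by
    obtain ⟨k, hk⟩ := T.surj c hc
    exact ⟨π k, by simpa using hk⟩

lemma permM_poly {μ : Partition n} (T : Placement μ) (π : Equiv.Perm (Fin n)) :
    permM F μ.parts π (polytabloid F T) = polytabloid F (T.move π) := by
  unfold polytabloid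
  rw [map_sum]
  apply Finset.sum_bij (fun σ _ => π * σ * π⁻¹)
  · intro σ hσ
    rw [mem_colStab] at *
    intro k
    simp [Placement.move, hσ]
  · intro σ _ τ _ h
    exact mul_left_cancel (mul_right_cancel h)
  · intro σ hσ
    refine ⟨π⁻¹ * σ * π, ?_, by group⟩
    rw [mem_colStab] at *
    intro k
    have := hσ (π k)
    simpa [Placement.move] using this
  · intro σ hσ
    rw [map_smul, permM_row]
    have h1 : rowTabloid T (σ * π⁻¹) = rowTabloid (T.move π) (π * σ * π⁻¹) := by
      apply Subtype.ext
      funext k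
      simp [rowTabloid, Placement.move]
    rw [h1]
    congr 2
    rw [Equiv.Perm.sign_mul, Equiv.Perm.sign_mul, Equiv.Perm.sign_inv]
    rcases Int.units_eq_one_or (Equiv.Perm.sign π) with h | h <;> simp [h]

lemma exists_move {μ : Partition n} (T U : Placement μ) : ∃ π, U = T.move π := by
  have h : ∀ k, ∃ k', T.pos k' = U.pos k := fun k => T.surj _ (U.mem k)
  choose p hp using h
  have hinj : Function.Injective p := by
    intro x y hxy
    apply U.inj
    rw [← hp x, ← hp y, hxy]
  refine ⟨(Equiv.ofBijective p (Finite.injective_iff_bijective.1 hinj))⁻¹, ?_⟩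
  cases U with
  | mk pos _ _ _ =>
    simp only [Placement.move, Placement.mk.injEq]
    funext k
    simp only [inv_inv, Equiv.ofBijective_apply]
    exact (hp k).symm

/-- One-element Garnir relation. -/
lemma garnir {μ : Partition n} (T : Placement μ) (k : Fin n) (c : ℕ) (hc1 : 1 ≤ c)
    (hc : c < (T.pos k).2) :
    polytabloid F T = ∑ y ∈ Finset.univ.filter (fun y => (T.pos y).2 = c),
      permM F μ.parts (Equiv.swap k y) (polytabloid F T) := by
  classical
  have hy0 : ∀ σ : Equiv.Perm (Fin n), ∃ y, σ ∈ colStab T →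
      (T.pos y).2 = c ∧ (T.pos (σ y)).1 = (T.pos (σ k)).1 := by
    intro σ
    by_cases hσ : σ ∈ colStab T
    · obtain ⟨m1, m2, m3⟩ := T.mem (σ k)
      rw [(mem_colStab T σ).1 hσ k] at m3
      obtain ⟨z, hz⟩ := T.surj ((T.pos (σ k)).1, c) ⟨m1, hc1, by simp only; omega⟩
      refine ⟨σ⁻¹ z, fun _ => ⟨?_, ?_⟩⟩
      · rw [(mem_colStab T _).1 (inv_mem_colStab hσ), hz]
      · simp [hz]
    · exact ⟨k, fun h => absurd h hσ⟩
  choose y0 hy0 using hy0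
  have huniq : ∀ σ ∈ colStab T, ∀ y, (T.pos y).2 = c → (T.pos (σ y)).1 = (T.pos (σ k)).1 →
      y = y0 σ := by
    intro σ hσ y h1 h2
    obtain ⟨h3, h4⟩ := hy0 σ hσ
    apply σ.injective
    apply T.inj
    apply Prod.ext
    · rw [h2, h4]
    · rw [(mem_colStab T σ).1 hσ, (mem_colStab T σ).1 hσ, h1, h3]
  have hexp : (∑ y ∈ Finset.univ.filter (fun y => (T.pos y).2 = c),
      permM F μ.parts (Equiv.swap k y) (polytabloid F T))
      = ∑ σ ∈ colStab T, ∑ y ∈ Finset.univ.filter (fun y => (T.pos y).2 = c),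
        ((Equiv.Perm.sign σ : ℤ) : F) •
          Finsupp.single (rowTabloid T (σ * Equiv.swap k y)) (1:F) := by
    rw [Finset.sum_comm]
    apply Finset.sum_congr rfl
    intro y _
    unfold polytabloid
    rw [map_sum]
    apply Finset.sum_congr rfl
    intro σ _
    rw [map_smul, permM_row, Equiv.swap_inv]
  have hsplit : ∀ σ ∈ colStab T, (∑ y ∈ Finset.univ.filter (fun y => (T.pos y).2 = c),
        ((Equiv.Perm.sign σ : ℤ) : F) •
          Finsupp.single (rowTabloid T (σ * Equiv.swap k y)) (1:F))
      = ((Equiv.Perm.sign σ : ℤ) : F) • Finsupp.single (rowTabloid T σ) (1:F)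
        + ∑ y ∈ (Finset.univ.filter (fun y => (T.pos y).2 = c)).erase (y0 σ),
          ((Equiv.Perm.sign σ : ℤ) : F) •
          Finsupp.single (rowTabloid T (σ * Equiv.swap k y)) (1:F) := by
    intro σ hσ
    obtain ⟨h3, h4⟩ := hy0 σ hσ
    rw [← Finset.add_sum_erase _ _ (show y0 σ ∈ Finset.univ.filter (fun y => (T.pos y).2 = c) by
      simpa using h3)]
    have : rowTabloid T (σ * Equiv.swap k (y0 σ)) = rowTabloid T σ := by
      apply Subtype.ext
      funext x
      simp only [rowTabloid, Equiv.Perm.mul_apply]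
      rw [Equiv.swap_apply_def]
      split_ifs with h1 h2
      · rw [h1, h4]
      · rw [h2, h4]
      · rfl
    rw [this]
  rw [hexp, Finset.sum_congr rfl hsplit, Finset.sum_add_distrib, Finset.sum_sigma']
  rw [eq_comm]
  apply add_eq_left.2
  apply Finset.sum_involution (fun p _ => ⟨p.1 * Equiv.swap p.2 (y0 p.1), y0 p.1⟩)
  · rintro ⟨σ, y⟩ hp
    simp only [Finset.mem_sigma, Finset.mem_erase, Finset.mem_filter, Finset.mem_univ,
      true_and] at hp
    obtain ⟨hσ, hne, hyc⟩ := hp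
    obtain ⟨h3, h4⟩ := hy0 σ hσ
    have hk0 : k ≠ y0 σ := by rintro h; rw [← h] at h3; omega
    have hky : k ≠ y := by rintro rfl; omega
    have h5 : rowTabloid T (σ * Equiv.swap y (y0 σ) * Equiv.swap k (y0 σ))
        = rowTabloid T (σ * Equiv.swap k y) := by
      apply Subtype.ext
      funext x
      simp only [rowTabloid, Equiv.Perm.mul_apply]
      by_cases x1 : x = k
      · subst x1; simp
      · by_cases x2 : x = y
        · subst x2
          rw [Equiv.swap_apply_of_ne_of_ne x1 hne]
          simp [h4]
        · by_cases x3 : x = y0 σ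
          · rw [Equiv.swap_apply_of_ne_of_ne (a := k) (b := y) x1 x2, x3, Equiv.swap_apply_right,
              Equiv.swap_apply_of_ne_of_ne hky hk0, h4]
          · rw [Equiv.swap_apply_of_ne_of_ne x1 x3, Equiv.swap_apply_of_ne_of_ne x2 x3,
              Equiv.swap_apply_of_ne_of_ne x1 x2]
    simp only [h5]
    rw [Equiv.Perm.sign_mul, Equiv.Perm.sign_swap hne, ← add_smul]
    simp
  · rintro ⟨σ, y⟩ hp _ heq
    simp only [Finset.mem_sigma, Finset.mem_erase, Finset.mem_filter, Finset.mem_univ,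
      true_and] at hp
    simp only [Sigma.mk.injEq, heq_eq_eq] at heq
    exact hp.2.1 heq.2.symm
  · rintro ⟨σ, y⟩ hp
    simp only [Finset.mem_sigma, Finset.mem_erase, Finset.mem_filter, Finset.mem_univ,
      true_and] at hp
    obtain ⟨hσ, hne, hyc⟩ := hp
    obtain ⟨h3, h4⟩ := hy0 σ hσ
    have hσ' : σ * Equiv.swap y (y0 σ) ∈ colStab T :=
      mul_mem_colStab hσ (swap_mem_colStab (hyc.trans h3.symm))
    have hk0 : k ≠ y0 σ := by rintro h; rw [← h] at h3; omega
    have hky : k ≠ y := by rintro rfl; omega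
    have e : y0 (σ * Equiv.swap y (y0 σ)) = y := by
      symm
      apply huniq _ hσ' y hyc
      simp only [Equiv.Perm.mul_apply]
      rw [Equiv.swap_apply_left, Equiv.swap_apply_of_ne_of_ne hky hk0, h4]
    simp only [e]
    rw [Equiv.swap_comm (y0 σ) y, mul_assoc, Equiv.swap_mul_self, mul_one]
  · rintro ⟨σ, y⟩ hp
    simp only [Finset.mem_sigma, Finset.mem_erase, Finset.mem_filter, Finset.mem_univ,
      true_and] at hp ⊢
    obtain ⟨hσ, hne, hyc⟩ := hp
    obtain ⟨h3, h4⟩ := hy0 σ hσ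
    have hσ' : σ * Equiv.swap y (y0 σ) ∈ colStab T :=
      mul_mem_colStab hσ (swap_mem_colStab (hyc.trans h3.symm))
    have hk0 : k ≠ y0 σ := by rintro h; rw [← h] at h3; omega
    have hky : k ≠ y := by rintro rfl; omega
    have e : y = y0 (σ * Equiv.swap y (y0 σ)) := by
      apply huniq _ hσ' y hyc
      simp only [Equiv.Perm.mul_apply]
      rw [Equiv.swap_apply_left, Equiv.swap_apply_of_ne_of_ne hky hk0, h4]
    exact ⟨hσ', by rw [← e]; exact hne.symm, h3⟩

/-- Elements of the Specht module are killed by the raising maps. -/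
lemma raising {μ : Partition n} (v : PermMod F n μ.parts) (hv : v ∈ Specht F μ)
    (h : Fin n → ℕ) (i : ℕ) (hi : 1 ≤ i) :
    ∑ k ∈ Finset.univ.filter (fun k => h k = i),
      evL F μ.parts (Function.update h k (i+1)) v = 0 := by
  classical
  induction hv using Submodule.span_induction with
  | zero => simp
  | add x y _ _ hx hy => simp only [map_add, Finset.sum_add_distrib, hx, hy, add_zero]
  | smul r x _ hx => simp only [map_smul, ← Finset.smul_sum, hx, smul_zero]
  | mem x hx =>
    obtain ⟨U, rfl⟩ := hx
    simp only [polytabloid, map_sum, map_smul, evL_row]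
    rw [← Finset.sum_product']
    simp only [smul_eq_mul, mul_ite, mul_one, mul_zero]
    rw [← Finset.sum_filter]
    have hz : ∀ p : Fin n × Equiv.Perm (Fin n), ∃ k', (U.pos (p.2 p.1)).1 = i + 1 →
        U.pos (p.2 k') = (i, (U.pos (p.2 p.1)).2) := by
      intro p
      by_cases hp : (U.pos (p.2 p.1)).1 = i + 1
      · obtain ⟨m1, m2, m3⟩ := U.mem (p.2 p.1)
        obtain ⟨z, hz⟩ := U.surj (i, (U.pos (p.2 p.1)).2) ⟨hi, m2, by
          have := μ.antitone (i := i) (j := i+1) (by omega) (by omega)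
          rw [hp] at m3
          exact m3.trans this⟩
        exact ⟨p.2⁻¹ z, fun _ => by simp [hz]⟩
      · exact ⟨p.1, fun h => absurd h hp⟩
    choose z hz using hz
    -- the facts about a pair in the index set
    have facts : ∀ k σ, (fun x => (U.pos (σ x)).1) = Function.update h k (i+1) → σ ∈ colStab U →
        (U.pos (σ k)).1 = i + 1 ∧ z (k, σ) ≠ k ∧ h (z (k, σ)) = i ∧
        (U.pos (σ (z (k, σ)))).1 = i ∧ (U.pos (z (k, σ))).2 = (U.pos k).2 := by
      intro k σ h1 hσ
      have e1 : (U.pos (σ k)).1 = i + 1 := by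
        have := congrFun h1 k
        simpa using this
      have e2 := hz (k, σ) e1
      simp only at e2
      have e3 : z (k, σ) ≠ k := by
        intro hcon
        rw [hcon] at e2
        have := congrArg Prod.fst e2
        simp only at this
        omega
      refine ⟨e1, e3, ?_, by rw [e2], ?_⟩
      · have := congrFun h1 (z (k, σ))
        rw [Function.update_of_ne e3] at this
        rw [← this]
        simp [e2]
      · have := congrArg Prod.snd e2
        simp only at this
        rwa [(mem_colStab U σ).1 hσ, (mem_colStab U σ).1 hσ] at this
    have facts2 : ∀ k σ, (fun x => (U.pos (σ x)).1) = Function.update h k (i+1) → σ ∈ colStab U →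
        h k = i →
        (fun x => (U.pos ((σ * Equiv.swap k (z (k, σ))) x)).1)
          = Function.update h (z (k, σ)) (i+1) ∧
        σ * Equiv.swap k (z (k, σ)) ∈ colStab U := by
      intro k σ h1 hσ hk
      obtain ⟨e1, e2, e3, e4, e5⟩ := facts k σ h1 hσ
      refine ⟨?_, mul_mem_colStab hσ (swap_mem_colStab e5.symm)⟩
      funext x
      simp only [Equiv.Perm.mul_apply]
      by_cases x1 : x = z (k, σ)
      · rw [x1]; simp [e1]
      · rw [Function.update_of_ne x1]
        by_cases x2 : x = k
        · rw [x2, Equiv.swap_apply_left, e4, hk]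
        · rw [Equiv.swap_apply_of_ne_of_ne x2 x1]
          have := congrFun h1 x
          rw [Function.update_of_ne x2] at this
          exact this
    apply Finset.sum_involution (fun p _ => (z p, p.2 * Equiv.swap p.1 (z p)))
    · rintro ⟨k, σ⟩ hp
      simp only [Finset.mem_filter, Finset.mem_product, Finset.mem_univ, true_and] at hp
      obtain ⟨⟨hk, hσ⟩, h1⟩ := hp
      obtain ⟨e1, e2, e3, e4, e5⟩ := facts k σ h1 hσ
      simp only
      rw [Equiv.Perm.sign_mul, Equiv.Perm.sign_swap e2.symm]
      simp
    · rintro ⟨k, σ⟩ hp _ heq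
      simp only [Finset.mem_filter, Finset.mem_product, Finset.mem_univ, true_and] at hp
      obtain ⟨⟨hk, hσ⟩, h1⟩ := hp
      obtain ⟨e1, e2, e3, e4, e5⟩ := facts k σ h1 hσ
      exact e2 (congrArg Prod.fst heq)
    swap
    · rintro ⟨k, σ⟩ hp
      simp only [Finset.mem_filter, Finset.mem_product, Finset.mem_univ, true_and] at hp
      obtain ⟨⟨hk, hσ⟩, h1⟩ := hp
      obtain ⟨e1, e2, e3, e4, e5⟩ := facts k σ h1 hσ
      obtain ⟨f1, f2⟩ := facts2 k σ h1 hσ hk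
      have hzz : z (z (k, σ), σ * Equiv.swap k (z (k, σ))) = k := by
        obtain ⟨g1, g2, g3, g4, g5⟩ := facts _ _ f1 f2
        apply (σ * Equiv.swap k (z (k, σ))).injective
        apply U.inj
        apply Prod.ext
        · rw [g4, Equiv.Perm.mul_apply, Equiv.swap_apply_left, e4]
        · rw [(mem_colStab U _).1 f2, (mem_colStab U _).1 f2, g5, e5]
      simp only [hzz]
      rw [Equiv.swap_comm (z (k, σ)) k, mul_assoc, Equiv.swap_mul_self, mul_one]
    · rintro ⟨k, σ⟩ hp
      simp only [Finset.mem_filter, Finset.mem_product, Finset.mem_univ, true_and] at hp ⊢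
      obtain ⟨⟨hk, hσ⟩, h1⟩ := hp
      obtain ⟨e1, e2, e3, e4, e5⟩ := facts k σ h1 hσ
      obtain ⟨f1, f2⟩ := facts2 k σ h1 hσ hk
      exact ⟨⟨e3, f2⟩, f1⟩

lemma poly_mem {μ : Partition n} (T : Placement μ) : polytabloid F T ∈ Specht F μ :=
  Submodule.subset_span ⟨T, rfl⟩

lemma hom_eq_zero {α β : Partition n} {f : ↥(Specht F α) →ₗ[F] PermMod F n β.parts}
    (hf : ∀ T : Placement α, f ⟨polytabloid F T, poly_mem T⟩ = 0) : f = 0 := by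
  apply LinearMap.ext
  rintro ⟨x, hx⟩
  rw [LinearMap.zero_apply]
  induction hx using Submodule.span_induction with
  | zero => exact map_zero f
  | add x y hx hy h1 h2 =>
    have := map_add f ⟨x, hx⟩ ⟨y, hy⟩
    rw [h1, h2, add_zero] at this
    exact this
  | smul r x hx h1 =>
    have := map_smul f r ⟨x, hx⟩
    rw [h1, smul_zero] at this
    exact this
  | mem x hx =>
    obtain ⟨U, rfl⟩ := hx
    exact hf U

lemma hom_col {α β : Partition n} {f : ↥(Specht F α) →ₗ[F] PermMod F n β.parts}
    (hf : f ∈ SpechtHom F α β.parts (Specht F β)) (T : Placement α) (g : Fin n → ℕ)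
    {π : Equiv.Perm (Fin n)} (hπ : π ∈ colStab T) :
    evL F β.parts (g ∘ π) (f ⟨polytabloid F T, poly_mem T⟩)
      = ((Equiv.Perm.sign π : ℤ) : F) * evL F β.parts g (f ⟨polytabloid F T, poly_mem T⟩) := by
  have h := hf.2 π (((Equiv.Perm.sign π : ℤ) : F) • ⟨polytabloid F T, poly_mem T⟩)
    ⟨polytabloid F T, poly_mem T⟩ (permM_poly_col T hπ).symm
  rw [← evL_permM, ← h, map_smul, map_smul, smul_eq_mul]

lemma hom_zero_of_chain (hchar : ringChar F ≠ 2) {α β : Partition n} {a b : ℕ}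
    (hs : OneBoxShift α β a b)
    {f : ↥(Specht F α) →ₗ[F] PermMod F n β.parts}
    (hf : f ∈ SpechtHom F α β.parts (Specht F β)) (T : Placement α)
    (H : ∀ g, Adm T β g → Pre T a g b →
      evL F β.parts g (f ⟨polytabloid F T, poly_mem T⟩) = 0) : f = 0 := by
  classical
  have h2 : (2 : F) ≠ 0 := Ring.two_ne_zero hchar
  have hX1 : ∀ g k k', k ≠ k' → (T.pos k).2 = (T.pos k').2 → g k = g k' →
      evL F β.parts g (f ⟨polytabloid F T, poly_mem T⟩) = 0 := by
    intro g k k' hne hc hg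
    have h := hom_col hf T g (swap_mem_colStab hc)
    have e : g ∘ Equiv.swap k k' = g := by
      funext x
      simp only [Function.comp]
      rw [Equiv.swap_apply_def]
      split_ifs with h1 h2
      · rw [h1, hg]
      · rw [h2, hg]
      · rfl
    rw [e, Equiv.Perm.sign_swap hne] at h
    simp only [Units.val_neg, Units.val_one, Int.cast_neg, Int.cast_one, neg_mul, one_mul] at h
    have h3 : (2:F) * evL F β.parts g (f ⟨polytabloid F T, poly_mem T⟩) = 0 := by
      linear_combination h
    exact (mul_eq_zero.1 h3).resolve_left h2
  have hX2 : ∀ (h : Fin n → ℕ) i, 1 ≤ i →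
      ∑ k ∈ Finset.univ.filter (fun k => h k = i),
        evL F β.parts (Function.update h k (i+1)) (f ⟨polytabloid F T, poly_mem T⟩) = 0 :=
    fun h i hi => raising _ (hf.1 _) h i hi
  have hX3 : ∀ g k c, 1 ≤ c → c < (T.pos k).2 →
      evL F β.parts g (f ⟨polytabloid F T, poly_mem T⟩)
        = ∑ y ∈ Finset.univ.filter (fun y => (T.pos y).2 = c),
          evL F β.parts (g ∘ Equiv.swap k y) (f ⟨polytabloid F T, poly_mem T⟩) := by
    intro g k c hc1 hc
    have e : (⟨polytabloid F T, poly_mem T⟩ : ↥(Specht F α))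
        = ∑ y ∈ Finset.univ.filter (fun y => (T.pos y).2 = c),
          ⟨polytabloid F (T.move (Equiv.swap k y)), poly_mem _⟩ := by
      apply Subtype.ext
      rw [Submodule.coe_sum]
      simp only [← permM_poly]
      exact garnir T k c hc1 hc
    conv_lhs => rw [e]
    rw [map_sum, map_sum]
    apply Finset.sum_congr rfl
    intro y _
    rw [← evL_permM, ← hf.2 (Equiv.swap k y) ⟨polytabloid F (T.move (Equiv.swap k y)), poly_mem _⟩
      ⟨polytabloid F T, poly_mem T⟩ (permM_poly T _).symm]
  have hT : f ⟨polytabloid F T, poly_mem T⟩ = 0 := by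
    apply Finsupp.ext
    intro t
    rw [← evL_tab, Finsupp.zero_apply]
    by_cases hc : ∀ k k', (T.pos k).2 = (T.pos k').2 → t.1 k = t.1 k' → k = k'
    · exact core (X := fun g => evL F β.parts g (f ⟨polytabloid F T, poly_mem T⟩))
        hs hX1 hX2 hX3 H t.1 ⟨t.2, hc⟩
    · push Not at hc
      obtain ⟨x, y, h1, h2, h3⟩ := hc
      exact hX1 _ x y h3 h1 h2
  apply hom_eq_zero
  intro U
  obtain ⟨π, rfl⟩ := exists_move T U
  rw [hf.2 π _ ⟨polytabloid F T, poly_mem T⟩ (permM_poly T π).symm, hT, map_zero]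

lemma inj_of_zero {α β : Partition n}
    (φ : (↥(Specht F α) →ₗ[F] PermMod F n β.parts) →ₗ[F] F)
    (h : ∀ f ∈ SpechtHom F α β.parts (Specht F β), φ f = 0 → f = 0) :
    ∃ ψ : ↥(SpechtHom F α β.parts (Specht F β)) →ₗ[F] F, Function.Injective ψ := by
  refine ⟨φ.comp (SpechtHom F α β.parts (Specht F β)).subtype, ?_⟩
  rintro ⟨f, hf⟩ ⟨f', hf'⟩ hff
  have h1 : φ f = φ f' := hff
  have h2 := h (f + (-1 : F) • f') (Submodule.add_mem _ hf (Submodule.smul_mem _ _ hf'))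
    (by rw [map_add, map_smul, h1, smul_eq_mul]; ring)
  apply Subtype.ext
  apply LinearMap.ext
  intro x
  apply Finsupp.ext
  intro t
  have h3 := DFunLike.congr_fun (LinearMap.congr_fun h2 x) t
  simp only [LinearMap.add_apply, LinearMap.smul_apply, Finsupp.add_apply, Finsupp.smul_apply,
    LinearMap.zero_apply, Finsupp.zero_apply, smul_eq_mul] at h3
  linear_combination h3

/-- There is an injective functional on the homomorphism space. -/
lemma exists_functional (hchar : ringChar F ≠ 2) {α β : Partition n} {a b : ℕ}
    (hs : OneBoxShift α β a b) :
    ∃ φ : ↥(SpechtHom F α β.parts (Specht F β)) →ₗ[F] F, Function.Injective φ := by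
  by_cases hT : Nonempty (Placement α)
  · obtain ⟨T⟩ := hT
    by_cases hg : ∃ g0, Adm T β g0 ∧ Pre T a g0 b
    · obtain ⟨g0, hg0, hp0⟩ := hg
      apply inj_of_zero ((evL F β.parts g0).comp
        (LinearMap.applyₗ (⟨polytabloid F T, poly_mem T⟩ : ↥(Specht F α))))
      intro f hf h0
      apply hom_zero_of_chain hchar hs hf T
      intro g hg hp
      obtain ⟨π, hπ, rfl⟩ := core_perm hs hg hg0 hp hp0
      rw [hom_col hf T g0 hπ]
      have h1 : evL F β.parts g0 (f ⟨polytabloid F T, poly_mem T⟩) = 0 := h0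
      rw [h1, mul_zero]
    · apply inj_of_zero 0
      intro f hf _
      apply hom_zero_of_chain hchar hs hf T
      intro g h1 h2
      exact absurd ⟨g, h1, h2⟩ hg
  · apply inj_of_zero 0
    intro f hf _
    apply hom_eq_zero
    intro T
    exact absurd ⟨T⟩ hT

end Alg

/-- Let `F` be a field of characteristic not equal to `2`, let `α` be a
partition of `n`, and let `β` be a one-box-shift of `α`.  Then
`dim_F Hom_{FΣ_n}(S^α, S^β) ≤ 1`. -/
theorem stmt4 (F : Type*) [Field F] (hchar : ringChar F ≠ 2)
    {n : ℕ} (α β : Partition n) (hshift : ∃ a b : ℕ, OneBoxShift α β a b) :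
    Module.rank F ↥(SpechtHom F α β.parts (Specht F β)) ≤ 1 := by
  obtain ⟨a, b, hs⟩ := hshift
  obtain ⟨φ, hφ⟩ := exists_functional hchar hs
  have h := LinearMap.rank_le_of_injective φ hφ
  rwa [Module.rank_self] at h

end CarterPayne
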